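/- For every m≥4 the following three identities hold: (1) B((−t_m+4t_{m-1}+t_{m-2}−3)/2) = (m/44)(−25t_m+48t_{m-1}+31t_{m-2}) + (1/44)(173t_m−294t_{m-1}−213t_{m-2}) + (m+11)/4; (2) B((t_m+2t_{m-1}−t_{m-2}−3)/2) = (m/44)(−5t_m+36t_{m-1}−7t_{m-2}) + (1/22)(−8t_m−69t_{m-1}+59t_{m-2}) + (m+10)/4; (3) B((t_m+2t_{m-1}+t_{m-2}−3)/2) = (m/44)(3t_m+18t_{m-1}+13t_{m-2}) + (1/44)(3t_m−102t_{m-1}−51t_{m-2}) + (m+9)/4. -/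

import Mathlib

/-- The three-letter alphabet of the Tribonacci word. -/
inductive TLetter : Type
  | a | b | c
deriving DecidableEq

/-- The Tribonacci substitution σ(a)=ab, σ(b)=ac, σ(c)=a. -/
def tsubst : TLetter → List TLetter
  | .a => [.a, .b]
  | .b => [.a, .c]
  | .c => [.a]

/-- `Tword m = σ^m(a)`, the m-th finite Tribonacci word. -/
def Tword : ℕ → List TLetter
  | 0 => [.a]
  | n + 1 => (Tword n).flatMap tsubst

/-- The prefix 𝕋[1,n] of the Tribonacci word of length n
(each `Tword n` is a prefix of the next and has length ≥ n). -/
def TPrefix (n : ℕ) : List TLetter := (Tword n).take n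

/-- A word is a factor of the Tribonacci word 𝕋. -/
def IsFactorT (w : List TLetter) : Prop := ∃ m, w <:+: Tword m

/-- `tribAux i = t_{i-2}`: Tribonacci numbers, shifted so that the index is a natural. -/
def tribAux : ℕ → ℕ
  | 0 => 0
  | 1 => 1
  | 2 => 1
  | n + 3 => tribAux (n + 2) + tribAux (n + 1) + tribAux n

/-- The Tribonacci numbers `t m` for `m : ℤ`: t₋₂=0, t₋₁=1, t₀=1,
`t m = t (m-1) + t (m-2) + t (m-3)` for m ≥ 1. (Junk value 0 below -2.) -/
def t (m : ℤ) : ℕ := tribAux (m + 2).toNat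

/-- Kernel numbers: k₀=0, k₁=k₂=1, `k m = k (m-1) + k (m-2) + k (m-3) - 1` for m ≥ 3. -/
def kAux : ℕ → ℕ
  | 0 => 0
  | 1 => 1
  | 2 => 1
  | n + 3 => kAux (n + 2) + kAux (n + 1) + kAux n - 1

def kker (m : ℤ) : ℕ := kAux m.toNat

/-- `A n`: the number of distinct nonempty words w with ww a factor of 𝕋[1,n]. -/
noncomputable def A (n : ℕ) : ℕ := Nat.card {w : List TLetter // w ≠ [] ∧ (w ++ w) <:+: TPrefix n}

/-- `B n`: the number of occurrences of squares in 𝕋[1,n], i.e. of pairs (w,i) with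
w nonempty, i ≥ 1, ww occurring in 𝕋 at position i and i + 2|w| - 1 ≤ n. -/
noncomputable def B (n : ℕ) : ℕ :=
  Nat.card {p : List TLetter × ℕ // p.1 ≠ [] ∧ 1 ≤ p.2 ∧
    p.2 + 2 * p.1.length - 1 ≤ n ∧ (p.1 ++ p.1) <+: (TPrefix n).drop (p.2 - 1)}

/-- `C n`: the number of distinct nonempty words w with www a factor of 𝕋[1,n]. -/
noncomputable def C (n : ℕ) : ℕ := Nat.card {w : List TLetter // w ≠ [] ∧ (w ++ w ++ w) <:+: TPrefix n}

/-- `D n`: the number of occurrences of cubes in 𝕋[1,n], i.e. of pairs (w,i) with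
w nonempty, i ≥ 1, www occurring in 𝕋 at position i and i + 3|w| - 1 ≤ n. -/
noncomputable def D (n : ℕ) : ℕ :=
  Nat.card {p : List TLetter × ℕ // p.1 ≠ [] ∧ 1 ≤ p.2 ∧
    p.2 + 3 * p.1.length - 1 ≤ n ∧ (p.1 ++ p.1 ++ p.1) <+: (TPrefix n).drop (p.2 - 1)}

namespace Tribonacci

/-- The `n`-th letter (counting from `0`) of the infinite Tribonacci word. -/
def letter (n : ℕ) : TLetter := (Tword n).getD n .a

/-- The length of `σ` applied to the prefix of length `n` of the Tribonacci word. -/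
def phi : ℕ → ℕ
  | 0 => 0
  | n + 1 => phi n + (tsubst (letter n)).length

theorem Tword_prefix_succ (m : ℕ) : Tword m <+: Tword (m + 1) := by
  induction m with
  | zero => exact ⟨[.b], rfl⟩
  | succ m ih =>
    obtain ⟨s, hs⟩ := ih
    refine ⟨s.flatMap tsubst, ?_⟩
    rw [Tword, Tword, ← List.flatMap_append, hs]

theorem Tword_prefix_of_le {m k : ℕ} (h : m ≤ k) : Tword m <+: Tword k := by
  induction k, h using Nat.le_induction with
  | base => exact List.prefix_rfl
  | succ k _ ih => exact ih.trans (Tword_prefix_succ k)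

theorem length_le_length_flatMap_tsubst (l : List TLetter) :
    l.length ≤ (l.flatMap tsubst).length := by
  induction l with
  | nil => simp
  | cons y l ih => cases y <;> simp [tsubst] at ih ⊢ <;> omega

theorem lt_length_Tword (m : ℕ) : m < (Tword m).length := by
  induction m with
  | zero => simp [Tword]
  | succ m ih =>
    obtain ⟨s, hs⟩ := Tword_prefix_of_le (Nat.zero_le m)
    have h := length_le_length_flatMap_tsubst s
    have ha : ((Tword 0).flatMap tsubst).length = 2 := rfl
    rw [← hs, List.length_append] at ih
    rw [Tword, ← hs, List.flatMap_append, List.length_append, ha]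
    have h0 : (Tword 0).length = 1 := rfl
    omega

theorem Tword_getElem? {m i : ℕ} (h : i < (Tword m).length) :
    (Tword m)[i]? = some (letter i) := by
  have key : ∀ {j k : ℕ}, j ≤ k → i < (Tword j).length → (Tword k)[i]? = (Tword j)[i]? := by
    intro j k hjk hi
    obtain ⟨s, hs⟩ := Tword_prefix_of_le hjk
    rw [← hs, List.getElem?_append_left hi]
  have hi : (Tword i)[i]? = some (letter i) := by
    rw [letter, List.getD_eq_getElem?_getD, List.getElem?_eq_getElem (lt_length_Tword i)]
    rfl
  rcases le_total i m with him | him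
  · rw [key him (lt_length_Tword i), hi]
  · rw [← key him h, hi]

theorem map_letter_range {m n : ℕ} (h : n ≤ (Tword m).length) :
    (List.range n).map letter = (Tword m).take n := by
  apply List.ext_getElem?
  intro i
  rw [List.getElem?_take]
  split_ifs with hi
  · rw [Tword_getElem? (hi.trans_le h)]
    simp [hi]
  · simp; omega

theorem TPrefix_eq (n : ℕ) : TPrefix n = (List.range n).map letter :=
  (map_letter_range (lt_length_Tword n).le).symm

theorem length_flatMap_letter (n : ℕ) :
    (((List.range n).map letter).flatMap tsubst).length = phi n := by
  induction n with
  | zero => rfl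
  | succ n ih =>
    rw [List.range_succ, List.map_append, List.flatMap_append, List.length_append, ih, phi]
    simp

theorem map_letter_range_phi (n : ℕ) :
    (List.range (phi n)).map letter = ((List.range n).map letter).flatMap tsubst := by
  have h : ((List.range n).map letter).flatMap tsubst <+: Tword (n + 1) := by
    rw [map_letter_range (lt_length_Tword n).le, Tword]
    refine ⟨((Tword n).drop n).flatMap tsubst, ?_⟩
    rw [← List.flatMap_append, List.take_append_drop]
  rw [map_letter_range (m := n + 1) (by simpa only [length_flatMap_letter] using h.length_le),
    ← length_flatMap_letter n]
  exact (List.prefix_iff_eq_take.mp h).symm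

theorem tsubst_getElem? (n k : ℕ) (hk : k < (tsubst (letter n)).length) :
    (tsubst (letter n))[k]? = some (letter (phi n + k)) := by
  have h := map_letter_range_phi (n + 1)
  rw [List.range_succ, List.map_append, List.flatMap_append, ← map_letter_range_phi] at h
  have h' := congrArg (fun l => l[phi n + k]?) h
  have hlt : phi n + k < phi (n + 1) := by rw [phi]; omega
  simp [List.getElem?_append, hlt] at h'
  exact h'.symm

theorem phi_succ (n : ℕ) : phi (n + 1) = phi n + if letter n = .c then 1 else 2 := by
  rw [phi]; cases letter n <;> rfl

theorem letter_phi (n : ℕ) : letter (phi n) = .a := by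
  have h := tsubst_getElem? n 0 (by cases letter n <;> simp [tsubst])
  cases hn : letter n <;> simp [hn, tsubst] at h <;> exact h.symm

theorem letter_phi_add_one_of_a {n : ℕ} (hn : letter n = .a) : letter (phi n + 1) = .b := by
  have h := tsubst_getElem? n 1 (by simp [hn, tsubst])
  simp [hn, tsubst] at h
  exact h.symm

theorem letter_phi_add_one_of_b {n : ℕ} (hn : letter n = .b) : letter (phi n + 1) = .c := by
  have h := tsubst_getElem? n 1 (by simp [hn, tsubst])
  simp [hn, tsubst] at h
  exact h.symm

theorem phi_strictMono : StrictMono phi :=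
  strictMono_nat_of_lt_succ fun n => by rw [phi_succ]; split_ifs <;> omega

/-- The letter `c` is isolated. -/
theorem letter_succ_ne_c {n : ℕ} (hn : letter n = .c) : letter (n + 1) ≠ .c := by
  have cover : ∀ n, ∃ k, n = phi k ∨ (n = phi k + 1 ∧ letter k ≠ .c) := by
    intro n
    induction n with
    | zero => exact ⟨0, Or.inl rfl⟩
    | succ n ih =>
      obtain ⟨k, rfl | ⟨rfl, hk⟩⟩ := ih
      · by_cases hk : letter k = .c
        · exact ⟨k + 1, Or.inl (by simp [phi_succ, hk])⟩
        · exact ⟨k, Or.inr ⟨rfl, hk⟩⟩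
      · exact ⟨k + 1, Or.inl (by simp [phi_succ, hk])⟩
  obtain ⟨k, rfl | ⟨rfl, hk⟩⟩ := cover n
  · simp [letter_phi] at hn
  · have : phi k + 1 + 1 = phi (k + 1) := by simp [phi_succ, hk]
    rw [this, letter_phi]; decide

/-- If `L` is the length of the longest common suffix of the prefixes of lengths `q` and `r` of
the Tribonacci word, then `rho q r = r - L`. -/
def rho : ℕ → ℕ → ℕ
  | q + 1, r + 1 => if letter q = letter r then rho q r else r + 1
  | _, r => r

theorem rho_zero (r : ℕ) : rho 0 r = r := by cases r <;> rfl

theorem rho_succ (q r : ℕ) :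
    rho (q + 1) (r + 1) = if letter q = letter r then rho q r else r + 1 := rfl

theorem rho_le (q r : ℕ) : rho q r ≤ r := by
  induction q generalizing r with
  | zero => rw [rho_zero]
  | succ q ih =>
    cases r with
    | zero => rfl
    | succ r =>
      rw [rho_succ]
      split_ifs
      · exact (ih r).trans r.le_succ
      · rfl

theorem sub_le_rho (q r : ℕ) : r - q ≤ rho q r := by
  induction q generalizing r with
  | zero => rw [rho_zero]; omega
  | succ q ih =>
    cases r with
    | zero => simp
    | succ r =>
      rw [rho_succ]
      split_ifs
      · have := ih r; omega
      · omega

theorem rho_phi (q r : ℕ) : rho (phi q) (phi r) = phi (rho q r) := by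
  induction q generalizing r with
  | zero => rw [phi, rho_zero, rho_zero]
  | succ q ih =>
    cases r with
    | zero =>
      have : ∀ k, rho k 0 = 0 := fun k => Nat.le_zero.mp (rho_le k 0)
      rw [phi, this, this, phi]
    | succ r =>
      have ha := @letter_phi_add_one_of_a
      have hb := @letter_phi_add_one_of_b
      rw [rho_succ]
      cases hq : letter q <;> cases hr : letter r <;>
        simp [phi_succ, rho_succ, hq, hr, letter_phi, ih, ha, hb]

theorem rho_phi_add_one (q r : ℕ) : rho (phi q + 1) (phi r + 1) = phi (rho q r) := by
  simp [rho_succ, letter_phi, rho_phi]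

theorem letter_phi_add_one_ne_a {n : ℕ} (hn : letter n ≠ .c) : letter (phi n + 1) ≠ .a := by
  cases h : letter n
  · simp [letter_phi_add_one_of_a h]
  · simp [letter_phi_add_one_of_b h]
  · exact absurd h hn

theorem phi_succ_of_ne {n : ℕ} (hn : letter n ≠ .c) : phi (n + 1) = phi n + 2 := by
  simp [phi_succ, hn]

theorem rho_phi_succ_phi_add_one {q : ℕ} (hq : letter q ≠ .c) (r : ℕ) :
    rho (phi (q + 1)) (phi r + 1) = phi r + 1 := by
  rw [phi_succ_of_ne hq, rho_succ, letter_phi, if_neg (letter_phi_add_one_ne_a hq)]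

theorem rho_phi_add_one_phi_succ (q : ℕ) {r : ℕ} (hr : letter r ≠ .c) :
    rho (phi q + 1) (phi (r + 1)) = phi (r + 1) := by
  rw [phi_succ_of_ne hr, rho_succ, letter_phi, if_neg (letter_phi_add_one_ne_a hr).symm]

theorem sum_range_phi (F : ℕ → ℕ) (n : ℕ) :
    ∑ j ∈ Finset.range (phi n), F j =
      ∑ j ∈ Finset.range n, (F (phi j) + if letter j = .c then 0 else F (phi j + 1)) := by
  induction n with
  | zero => rfl
  | succ n ih =>
    rw [Finset.sum_range_succ, ← ih, phi_succ]
    split_ifs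
    · rw [Finset.sum_range_succ]; rfl
    · rw [Finset.sum_range_succ, Finset.sum_range_succ]; ring

/-- The number of squares ending at position `r`. -/
def squaresAt (r : ℕ) : ℕ := ∑ q ∈ Finset.range r, if rho q r ≤ q then 1 else 0

/-- The number of pairs `q < r` for which the word between the positions `q` and `r` is the
letter `y` followed by the longest common suffix of the prefixes of lengths `q` and `r`. -/
def almostSquaresAt (y : TLetter) (r : ℕ) : ℕ :=
  ∑ q ∈ Finset.range r, if rho q r = q + 1 ∧ letter q = y then 1 else 0

theorem sum_range_phi_add_one (F : ℕ → ℕ) (n : ℕ) :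
    ∑ j ∈ Finset.range (phi n + 1), F j = ∑ j ∈ Finset.range (n + 1), F (phi j) +
      ∑ j ∈ Finset.range n, if letter j = .c then 0 else F (phi j + 1) := by
  rw [Finset.sum_range_succ, sum_range_phi, Finset.sum_add_distrib, Finset.sum_range_succ]
  ring

theorem almost_square_zero_iff (y : TLetter) (r : ℕ) :
    (rho 0 r = 0 + 1 ∧ letter 0 = y) ↔ r = 1 ∧ y = .a := by
  rw [rho_zero]
  exact and_congr_right fun _ => eq_comm

theorem squaresAt_succ (r : ℕ) :
    squaresAt (r + 1) = ∑ q ∈ Finset.range r, if rho (q + 1) (r + 1) ≤ q + 1 then 1 else 0 := by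
  rw [squaresAt, Finset.sum_range_succ', rho_zero]
  simp

theorem almostSquaresAt_succ (y : TLetter) (r : ℕ) :
    almostSquaresAt y (r + 1) =
      (∑ q ∈ Finset.range r,
        if rho (q + 1) (r + 1) = q + 2 ∧ letter (q + 1) = y then 1 else 0) +
      if r = 0 ∧ y = .a then 1 else 0 := by
  rw [almostSquaresAt, Finset.sum_range_succ']
  simp only [almost_square_zero_iff, Nat.add_eq_right]

theorem phi_le_phi_add_one_iff (i j : ℕ) :
    phi i ≤ phi j + 1 ↔ i ≤ j ∨ (i = j + 1 ∧ letter j = .c) := by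
  rcases lt_trichotomy i (j + 1) with h | rfl | h
  · have := phi_strictMono.monotone (Nat.lt_succ_iff.mp h)
    constructor
    · intro _; left; omega
    · intro _; omega
  · rw [phi_succ]; split_ifs with hc <;> simp [hc]
  · have h1 := phi_strictMono h
    have h2 := phi_strictMono (Nat.lt_succ_self j)
    simp only [Nat.succ_eq_add_one] at h2
    constructor
    · intro _; omega
    · rintro (h3 | ⟨h3, _⟩) <;> omega

theorem phi_eq_phi_add_one_iff (i j : ℕ) :
    phi i = phi j + 1 ↔ i = j + 1 ∧ letter j = .c := by
  constructor
  · intro h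
    rcases (phi_le_phi_add_one_iff i j).mp h.le with h' | h'
    · have := phi_strictMono.monotone h'; omega
    · exact h'
  · rintro ⟨rfl, h⟩
    simp [phi_succ, h]

theorem phi_eq_phi_add_two_iff (i j : ℕ) :
    phi i = phi j + 2 ↔ i = j + 1 ∧ letter j ≠ .c := by
  constructor
  · intro h
    have hij : j < i := phi_strictMono.lt_iff_lt.mp (by omega)
    obtain ⟨k, rfl⟩ := Nat.exists_eq_add_of_lt hij
    cases k with
    | zero =>
      refine ⟨rfl, fun hc => ?_⟩
      simp [phi_succ, hc] at h
    | succ k =>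
      have h1 : phi (j + 1 + 1) ≤ phi (j + (k + 1) + 1) :=
        phi_strictMono.monotone (by omega)
      rw [h, phi_succ, phi_succ] at h1
      by_cases hc : letter j = .c
      · rw [if_pos hc, if_neg (letter_succ_ne_c hc)] at h1; omega
      · rw [if_neg hc] at h1; split_ifs at h1 <;> omega
  · rintro ⟨rfl, h⟩
    exact phi_succ_of_ne h

theorem squaresAt_phi_add_one (r : ℕ) :
    squaresAt (phi r + 1) = squaresAt r + almostSquaresAt .c r := by
  rw [squaresAt_succ, sum_range_phi, squaresAt, almostSquaresAt, ← Finset.sum_add_distrib]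
  refine Finset.sum_congr rfl fun q hq => ?_
  have hqr := phi_strictMono (Finset.mem_range.mp hq)
  simp only [rho_phi_add_one, phi_le_phi_add_one_iff]
  have h : (if letter q = .c then 0
      else if rho (phi q + 1 + 1) (phi r + 1) ≤ phi q + 1 + 1 then 1 else 0) = 0 := by
    split_ifs with hc hle
    · rfl
    · have h1 := rho_phi_succ_phi_add_one hc r
      have h2 := phi_strictMono.monotone (Nat.succ_le_of_lt (Finset.mem_range.mp hq))
      rw [Nat.succ_eq_add_one] at h2
      rw [phi_succ_of_ne hc] at h1 h2
      change rho (phi q + 2) (phi r + 1) ≤ phi q + 2 at hle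
      omega
    · rfl
  rw [h]
  split_ifs <;> first | rfl | omega | tauto

theorem squaresAt_phi_succ {r : ℕ} (hr : letter r ≠ .c) :
    squaresAt (phi (r + 1)) = squaresAt (r + 1) := by
  have hrr := phi_succ_of_ne hr
  rw [hrr, squaresAt_succ, squaresAt_succ, Finset.sum_range_succ, sum_range_phi]
  have key := fun q => rho_phi_add_one_phi_succ q hr
  rw [hrr] at key
  rw [key, if_neg (by omega), add_zero]
  refine Finset.sum_congr rfl fun q hq => ?_
  have hqr := phi_strictMono (Finset.mem_range.mp hq)
  rw [key, if_neg (by omega), zero_add]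
  split_ifs with h1 h2 h3 h4 h5
  · rw [rho_succ, h1, if_neg (Ne.symm hr)] at h2
    have := Finset.mem_range.mp hq; omega
  · rfl
  · rfl
  · have := rho_phi (q + 1) (r + 1)
    rw [hrr, phi_succ_of_ne h1] at this
    rw [this, ← phi_succ_of_ne h1, phi_strictMono.le_iff_le] at h3
    exact absurd h3 h4
  · have := rho_phi (q + 1) (r + 1)
    rw [hrr, phi_succ_of_ne h1] at this
    rw [this, ← phi_succ_of_ne h1, phi_strictMono.le_iff_le] at h3
    exact absurd h5 h3
  · rfl

theorem almostSquaresAt_phi_add_one (y : TLetter) (r : ℕ) :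
    almostSquaresAt y (phi r + 1) =
      (∑ q ∈ Finset.range r,
        ((if rho q r = q + 1 ∧ letter q ≠ .c ∧ letter (phi q + 1) = y then 1 else 0) +
          if q + 1 = r ∧ letter q ≠ .c ∧ y = .a then 1 else 0)) +
      if r = 0 ∧ y = .a then 1 else 0 := by
  have hphi : phi r = 0 ↔ r = 0 := phi_strictMono.injective.eq_iff (b := 0)
  rw [almostSquaresAt_succ, sum_range_phi]
  simp only [hphi, rho_phi_add_one, phi_eq_phi_add_two_iff]
  congr 1
  refine Finset.sum_congr rfl fun q hq => ?_
  congr 1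
  · simp only [and_assoc]
  · by_cases hc : letter q = .c
    · simp [hc]
    · have h1 := rho_phi_succ_phi_add_one hc r
      have h2 : phi r = phi (q + 1) ↔ r = q + 1 := phi_strictMono.injective.eq_iff
      have h3 := letter_phi (q + 1)
      rw [phi_succ_of_ne hc] at h1 h2 h3
      have h4 : phi r + 1 = phi q + 1 + 2 ↔ q + 1 = r := by omega
      simp only [hc, if_false, h1, h3, h4]
      simp [hc, @eq_comm _ TLetter.a]

theorem almostSquaresAt_b_phi_add_one (r : ℕ) :
    almostSquaresAt .b (phi r + 1) = almostSquaresAt .a r := by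
  rw [almostSquaresAt_phi_add_one, almostSquaresAt]
  simp only [reduceCtorEq, and_false, if_false, add_zero]
  refine Finset.sum_congr rfl fun q _ => ?_
  cases h : letter q <;> simp [letter_phi_add_one_of_a, letter_phi_add_one_of_b, h]

theorem almostSquaresAt_c_phi_add_one (r : ℕ) :
    almostSquaresAt .c (phi r + 1) = almostSquaresAt .b r := by
  rw [almostSquaresAt_phi_add_one, almostSquaresAt]
  simp only [reduceCtorEq, and_false, if_false, add_zero]
  refine Finset.sum_congr rfl fun q _ => ?_
  cases h : letter q <;> simp [letter_phi_add_one_of_a, letter_phi_add_one_of_b, h]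

theorem almostSquaresAt_a_phi_zero_add_one : almostSquaresAt .a (phi 0 + 1) = 1 := by
  simp [almostSquaresAt_phi_add_one]

theorem almostSquaresAt_a_phi_succ_add_one (r : ℕ) :
    almostSquaresAt .a (phi (r + 1) + 1) = if letter r = .c then 0 else 1 := by
  rw [almostSquaresAt_phi_add_one]
  have h : ∀ q, (if rho q (r + 1) = q + 1 ∧ letter q ≠ .c ∧ letter (phi q + 1) = .a
      then 1 else 0) = 0 := fun q =>
    if_neg fun h => letter_phi_add_one_ne_a h.2.1 h.2.2
  simp only [h, zero_add, Nat.add_right_cancel_iff]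
  rw [Finset.sum_range_succ, Finset.sum_eq_zero]
  · by_cases hc : letter r = .c <;> simp [hc]
  · intro q hq
    rw [if_neg]
    rintro ⟨rfl, _⟩
    simp at hq

theorem almostSquaresAt_phi_succ (y : TLetter) {r : ℕ} (hr : letter r ≠ .c) :
    almostSquaresAt y (phi (r + 1)) =
      (if y = .a then almostSquaresAt .c (r + 1) else 0) +
        if letter (phi r + 1) = y then 1 else 0 := by
  have hrr := phi_succ_of_ne hr
  have key := fun q => rho_phi_add_one_phi_succ q hr
  rw [hrr] at key
  rw [hrr, almostSquaresAt_succ, almostSquaresAt_succ, Finset.sum_range_succ, sum_range_phi]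
  simp only [key, reduceCtorEq, and_false, false_and, if_false, add_zero, true_and]
  congr 1
  have hsum : (if y = .a then ∑ q ∈ Finset.range r,
        (if rho (q + 1) (r + 1) = q + 2 ∧ letter (q + 1) = .c then 1 else 0) else 0) =
      ∑ q ∈ Finset.range r, if y = .a then
        (if rho (q + 1) (r + 1) = q + 2 ∧ letter (q + 1) = .c then 1 else 0) else 0 := by
    split_ifs <;> simp
  rw [hsum]
  refine Finset.sum_congr rfl fun q hq => ?_
  have hqr := phi_strictMono (Finset.mem_range.mp hq)
  rw [if_neg (by omega), zero_add]
  by_cases hc : letter q = .c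
  · simp [hc, rho_succ, hr.symm]
    rintro - rfl
    exact hr
  · have h1 := rho_phi (q + 1) (r + 1)
    have h2 := phi_eq_phi_add_one_iff (rho (q + 1) (r + 1)) (q + 1)
    have h3 := letter_phi (q + 1)
    rw [hrr, phi_succ_of_ne hc] at h1
    rw [phi_succ_of_ne hc] at h2 h3
    simp only [hc, if_false, h1, h2, h3]
    by_cases hy : y = .a
    · simp [hy]
    · simp [hy, Ne.symm hy]

/-- The number of occurrences of the letter `y` in the prefix of length `n`. -/
def letterCount (y : TLetter) (n : ℕ) : ℕ :=
  ∑ j ∈ Finset.range n, if letter j = y then 1 else 0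

/-- The number of occurrences of squares in the prefix of length `n` that end with `y`. -/
def squareCount (y : TLetter) (n : ℕ) : ℕ :=
  ∑ j ∈ Finset.range n, if letter j = y then squaresAt (j + 1) else 0

/-- The sum of `almostSquaresAt y` over the positions up to `n`. -/
def almostSquareCount (y : TLetter) (n : ℕ) : ℕ :=
  ∑ j ∈ Finset.range n, almostSquaresAt y (j + 1)

theorem letterCount_a (n : ℕ) : letterCount .a (phi n + 1) = n + 1 := by
  rw [letterCount, sum_range_phi_add_one]
  simp only [letter_phi, if_true, Finset.sum_const, Finset.card_range, smul_eq_mul, mul_one]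
  rw [Finset.sum_eq_zero, add_zero]
  intro q _
  split_ifs with h1 h2
  · rfl
  · exact absurd h2 (letter_phi_add_one_ne_a h1)
  · rfl

theorem letterCount_b (n : ℕ) : letterCount .b (phi n + 1) = letterCount .a n := by
  rw [letterCount, sum_range_phi_add_one, letterCount]
  simp only [letter_phi, reduceCtorEq, if_false, Finset.sum_const_zero, zero_add]
  refine Finset.sum_congr rfl fun q _ => ?_
  cases h : letter q <;> simp [letter_phi_add_one_of_a, letter_phi_add_one_of_b, h]

theorem letterCount_c (n : ℕ) : letterCount .c (phi n + 1) = letterCount .b n := by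
  rw [letterCount, sum_range_phi_add_one, letterCount]
  simp only [letter_phi, reduceCtorEq, if_false, Finset.sum_const_zero, zero_add]
  refine Finset.sum_congr rfl fun q _ => ?_
  cases h : letter q <;> simp [letter_phi_add_one_of_a, letter_phi_add_one_of_b, h]

theorem squaresAt_zero : squaresAt 0 = 0 := rfl

theorem sum_squaresAt (n : ℕ) : ∑ j ∈ Finset.range n, squaresAt (j + 1) =
    squareCount .a n + squareCount .b n + squareCount .c n := by
  rw [squareCount, squareCount, squareCount, ← Finset.sum_add_distrib, ← Finset.sum_add_distrib]
  refine Finset.sum_congr rfl fun q _ => ?_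
  cases letter q <;> simp

theorem squareCount_a (n : ℕ) : squareCount .a (phi n + 1) =
    squareCount .a n + squareCount .b n + squareCount .c n + almostSquareCount .c n := by
  rw [squareCount, sum_range_phi_add_one, Finset.sum_eq_zero (s := Finset.range n)]
  · simp only [letter_phi, if_true, squaresAt_phi_add_one, Finset.sum_range_succ' _ n]
    rw [squaresAt_zero, ← sum_squaresAt, almostSquareCount, ← Finset.sum_add_distrib]
    rfl
  · intro q _
    split_ifs with h1 h2
    · rfl
    · exact absurd h2 (letter_phi_add_one_ne_a h1)
    · rfl

theorem squareCount_b (n : ℕ) : squareCount .b (phi n + 1) = squareCount .a n := by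
  rw [squareCount, sum_range_phi_add_one, squareCount]
  simp only [letter_phi, reduceCtorEq, if_false, Finset.sum_const_zero, zero_add]
  refine Finset.sum_congr rfl fun q _ => ?_
  have h2 := squaresAt_phi_succ (r := q)
  cases h : letter q <;>
    simp [letter_phi_add_one_of_a, letter_phi_add_one_of_b, h, phi_succ] at h2 ⊢
  exact h2

theorem squareCount_c (n : ℕ) : squareCount .c (phi n + 1) = squareCount .b n := by
  rw [squareCount, sum_range_phi_add_one, squareCount]
  simp only [letter_phi, reduceCtorEq, if_false, Finset.sum_const_zero, zero_add]
  refine Finset.sum_congr rfl fun q _ => ?_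
  have h2 := squaresAt_phi_succ (r := q)
  cases h : letter q <;>
    simp [letter_phi_add_one_of_a, letter_phi_add_one_of_b, h, phi_succ] at h2 ⊢
  exact h2

theorem almostSquaresAt_zero (y : TLetter) : almostSquaresAt y 0 = 0 := rfl

theorem almostSquareCount_b (n : ℕ) :
    almostSquareCount .b (phi n + 1) = almostSquareCount .a n + letterCount .a n := by
  rw [almostSquareCount, sum_range_phi_add_one]
  simp only [almostSquaresAt_b_phi_add_one, Finset.sum_range_succ' _ n]
  rw [almostSquaresAt_zero, almostSquareCount, letterCount]
  congr 1
  refine Finset.sum_congr rfl fun q _ => ?_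
  have h2 := almostSquaresAt_phi_succ .b (r := q)
  cases h : letter q <;>
    simp [letter_phi_add_one_of_a, letter_phi_add_one_of_b, h, phi_succ] at h2 ⊢
  all_goals exact h2

theorem almostSquareCount_c (n : ℕ) :
    almostSquareCount .c (phi n + 1) = almostSquareCount .b n + letterCount .b n := by
  rw [almostSquareCount, sum_range_phi_add_one]
  simp only [almostSquaresAt_c_phi_add_one, Finset.sum_range_succ' _ n]
  rw [almostSquaresAt_zero, almostSquareCount, letterCount]
  congr 1
  refine Finset.sum_congr rfl fun q _ => ?_
  have h2 := almostSquaresAt_phi_succ .c (r := q)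
  cases h : letter q <;>
    simp [letter_phi_add_one_of_a, letter_phi_add_one_of_b, h, phi_succ] at h2 ⊢
  all_goals exact h2

theorem almostSquaresAt_c_succ_of_c {q : ℕ} (h : letter q = .c) :
    almostSquaresAt .c (q + 1) = 1 := by
  rw [almostSquaresAt, Finset.sum_eq_single q]
  · cases q with
    | zero => simp [rho_zero, h]
    | succ q =>
      have : letter q ≠ .c := fun hc => letter_succ_ne_c hc h
      simp [rho_succ, h, this]
  · intro k hk hne
    rw [if_neg]
    rintro ⟨h1, h2⟩
    have hk' := Finset.mem_range.mp hk
    cases k with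
    | zero => exact absurd h2 (by decide)
    | succ k =>
      have : letter k ≠ .c := fun hc => letter_succ_ne_c hc h2
      rw [rho_succ, h, if_neg this] at h1
      omega
  · simp

theorem almostSquareCount_a (n : ℕ) :
    almostSquareCount .a (phi n + 1) + 2 * letterCount .c n = n + 1 + almostSquareCount .c n := by
  rw [almostSquareCount, sum_range_phi_add_one, Finset.sum_range_succ',
    almostSquaresAt_a_phi_zero_add_one, almostSquareCount, letterCount]
  have h : ∀ m, (n + 1 : ℕ) + m = (∑ j ∈ Finset.range n, 1) + 1 + m := by simp
  rw [h, Finset.mul_sum, add_right_comm, add_right_comm (Finset.sum _ _), add_right_comm]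
  rw [add_right_comm (∑ j ∈ Finset.range n, 1), add_left_inj, ← Finset.sum_add_distrib,
    ← Finset.sum_add_distrib, ← Finset.sum_add_distrib]
  refine Finset.sum_congr rfl fun q _ => ?_
  rw [almostSquaresAt_a_phi_succ_add_one]
  have h2 := almostSquaresAt_phi_succ .a (r := q)
  have h3 := almostSquaresAt_c_succ_of_c (q := q)
  cases h : letter q <;>
    simp [letter_phi_add_one_of_a, letter_phi_add_one_of_b, h, phi_succ] at h2 h3 ⊢ <;> omega

theorem rho_add_le_iff (i j l : ℕ) :
    rho (i + l) (j + l) ≤ j ↔ ∀ k < l, letter (i + k) = letter (j + k) := by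
  induction l with
  | zero => simpa using rho_le i j
  | succ l ih =>
    rw [← add_assoc, ← add_assoc, rho_succ]
    simp only [Nat.lt_succ_iff_lt_or_eq, or_imp, forall_and, forall_eq, ← ih]
    split_ifs with h
    · simp [h]
    · simp only [h, and_false, iff_false]; omega

theorem rho_le_iff {q r : ℕ} (hqr : q ≤ r) :
    rho q r ≤ q ↔ r ≤ 2 * q ∧ ∀ k < r - q, letter (2 * q - r + k) = letter (q + k) := by
  by_cases h : r ≤ 2 * q
  · have := rho_add_le_iff (2 * q - r) q (r - q)
    rw [show 2 * q - r + (r - q) = q by omega, show q + (r - q) = r by omega] at this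
    simp [this, h]
  · have := sub_le_rho q r
    simp only [h, false_and, iff_false]; omega

theorem append_self_prefix_drop_iff {w : List TLetter} {s n : ℕ} (hn : s + 2 * w.length ≤ n) :
    (w ++ w) <+: (TPrefix n).drop s ↔
      w = (List.range w.length).map (fun k => letter (s + w.length + k)) ∧
        ∀ k < w.length, letter (s + k) = letter (s + w.length + k) := by
  have hdrop : ∀ i < 2 * w.length, ((TPrefix n).drop s)[i]? = some (letter (s + i)) := by
    intro i hi
    rw [TPrefix_eq, List.getElem?_drop, List.getElem?_map, List.getElem?_range (by omega)]
    rfl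
  rw [List.prefix_iff_getElem?]
  constructor
  · intro h
    have h1 : ∀ k (hk : k < w.length), letter (s + k) = w[k] := by
      intro k hk
      have := h k (by simp; omega)
      rw [hdrop k (by omega), List.getElem_append_left hk] at this
      exact Option.some.inj this
    have h2 : ∀ k (hk : k < w.length), letter (s + w.length + k) = w[k] := by
      intro k hk
      have := h (w.length + k) (by simp; omega)
      rw [hdrop _ (by omega), List.getElem_append_right (by omega), ← add_assoc] at this
      simpa using this
    refine ⟨List.ext_getElem (by simp) fun k hk _ => ?_, fun k hk => (h1 k hk).trans (h2 k hk).symm⟩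
    simp [h2 k hk]
  · rintro ⟨hw, h⟩ i hi
    have h2 : ∀ k (hk : k < w.length), w[k] = letter (s + w.length + k) := by
      intro k hk
      have := List.getElem_of_eq hw hk
      simpa using this
    have hi' : i < 2 * w.length := by simpa [two_mul] using hi
    rw [hdrop i hi']
    by_cases hiw : i < w.length
    · rw [List.getElem_append_left hiw, h2 i hiw, h i hiw]
    · rw [List.getElem_append_right (by omega), h2 _ (by omega)]
      congr 2; omega

theorem B_eq (n : ℕ) : B n = squareCount .a n + squareCount .b n + squareCount .c n := by
  classical
  let F : Finset (Σ _ : ℕ, ℕ) :=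
    (Finset.range (n + 1)).sigma fun r => (Finset.range r).filter fun q => rho q r ≤ q
  let f : (Σ _ : ℕ, ℕ) → List TLetter × ℕ := fun x =>
    ((List.range (x.1 - x.2)).map (fun k => letter (x.2 + k)), 2 * x.2 - x.1 + 1)
  have hF : ∀ x : Σ _ : ℕ, ℕ, x ∈ F ↔ x.1 < n + 1 ∧ x.2 < x.1 ∧ rho x.2 x.1 ≤ x.2 := by
    intro x; simp [F]
  have hcard : F.card = squareCount .a n + squareCount .b n + squareCount .c n := by
    rw [Finset.card_sigma, ← sum_squaresAt, Finset.sum_range_succ']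
    simp [squaresAt]
  have himage : {p : List TLetter × ℕ | p.1 ≠ [] ∧ 1 ≤ p.2 ∧
      p.2 + 2 * p.1.length - 1 ≤ n ∧ (p.1 ++ p.1) <+: (TPrefix n).drop (p.2 - 1)} = f '' F := by
    ext ⟨w, i⟩
    simp only [Set.mem_ofPred_eq, Set.mem_image, Finset.mem_coe, hF]
    constructor
    · rintro ⟨hw, hi, hn, hpre⟩
      have hlen := List.length_pos_iff.mpr hw
      obtain ⟨s, rfl⟩ := Nat.exists_eq_add_of_le' hi
      rw [Nat.add_sub_cancel] at hpre
      rw [append_self_prefix_drop_iff (by omega)] at hpre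
      refine ⟨⟨s + 2 * w.length, s + w.length⟩, ?_, ?_⟩
      · dsimp only
        refine ⟨by omega, by omega, ?_⟩
        rw [rho_le_iff (by omega)]
        refine ⟨by omega, fun k hk => ?_⟩
        rw [show 2 * (s + w.length) - (s + 2 * w.length) = s by omega]
        exact hpre.2 k (by omega)
      · refine Prod.ext ?_ (by simp only [f]; omega)
        simp only [f]
        rw [show s + 2 * w.length - (s + w.length) = w.length by omega]
        exact hpre.1.symm
    · rintro ⟨⟨r, q⟩, ⟨hr, hq, hrho⟩, hf⟩
      simp only at hr hq hrho
      obtain ⟨h1, h2⟩ := (rho_le_iff hq.le).mp hrho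
      obtain ⟨rfl, rfl⟩ := Prod.ext_iff.mp hf
      simp only [f, List.length_map, List.length_range]
      refine ⟨?_, by omega, by omega, ?_⟩
      · simp; omega
      · rw [append_self_prefix_drop_iff (by simp; omega)]
        simp only [List.length_map, List.length_range, Nat.add_sub_cancel]
        rw [show 2 * q - r + (r - q) = q by omega]
        exact ⟨rfl, h2⟩
  have hinj : Set.InjOn f F := by
    rintro ⟨r, q⟩ h ⟨r', q'⟩ h' heq
    simp only [Finset.mem_coe, hF] at h h'
    have h1 := ((rho_le_iff h.2.1.le).mp h.2.2).1
    have h1' := ((rho_le_iff h'.2.1.le).mp h'.2.2).1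
    have h2 := congrArg (fun p => p.1.length) heq
    have h3 := congrArg Prod.snd heq
    simp only [f, List.length_map, List.length_range] at h2 h3
    obtain rfl : q = q' := by omega
    obtain rfl : r = r' := by omega
    rfl
  rw [← hcard, ← Set.ncard_coe_finset, ← hinj.ncard_image, ← himage]
  rfl

theorem letterCount_add (n : ℕ) :
    letterCount .a n + letterCount .b n + letterCount .c n = n := by
  induction n with
  | zero => rfl
  | succ n ih =>
    simp only [letterCount, Finset.sum_range_succ] at ih ⊢
    cases letter n <;> simp only [reduceCtorEq, if_true, if_false] <;> omega

theorem B_phi_add_one (n : ℕ) :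
    B (phi n + 1) = B n + squareCount .a n + squareCount .b n + almostSquareCount .c n := by
  simp only [B_eq, squareCount_a, squareCount_b, squareCount_c]
  ring

/-- The `k`-th element of the orbit of `n` under `n ↦ phi n + 1`. -/
def orbit (n : ℕ) : ℕ → ℕ
  | 0 => n
  | k + 1 => phi (orbit n k) + 1

theorem B_orbit_two (n : ℕ) : B (orbit n 2) = B (orbit n 1) + B n + squareCount .a n +
    almostSquareCount .b n + almostSquareCount .c n + letterCount .b n := by
  simp only [orbit, B_phi_add_one, squareCount_a, squareCount_b, almostSquareCount_c, B_eq]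
  ring

theorem B_orbit_three (n : ℕ) : B (orbit n 3) = B (orbit n 2) + B (orbit n 1) + B n +
    (almostSquareCount .a n + almostSquareCount .b n + almostSquareCount .c n +
      2 * letterCount .a n + letterCount .b n) := by
  simp only [orbit, B_phi_add_one, squareCount_a, squareCount_b, squareCount_c,
    almostSquareCount_b, almostSquareCount_c, letterCount_b, B_eq]
  ring

theorem orbit_add (n i k : ℕ) : orbit (orbit n k) i = orbit n (k + i) := by
  induction i with
  | zero => rfl
  | succ i ih => rw [orbit, ih]; rfl

theorem B_orbit_four (n : ℕ) :
    B (orbit n 4) + B n + 2 * letterCount .c n = 2 * B (orbit n 3) + 3 * n + 3 := by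
  have h := B_orbit_three (orbit n 1)
  rw [orbit_add, orbit_add, orbit_add] at h
  have h3 := B_orbit_three n
  have ha := almostSquareCount_a n
  simp only [orbit, almostSquareCount_b, almostSquareCount_c, letterCount_a, letterCount_b] at *
  omega

theorem orbit_closed_form (n : ℕ) (z f : ℕ → ℚ)
    (hz : ∀ k, z (k + 3) = z (k + 2) + z (k + 1) + z k)
    (hc : 2 * (letterCount .c n : ℚ) + 1 = z 0) (hb : 2 * (letterCount .b n : ℚ) + 1 = z 1)
    (ha : 2 * (letterCount .a n : ℚ) + 1 = z 2)
    (hf : ∀ k, f (k + 4) = 2 * f (k + 3) - f k + 3 / 2 * z (k + 3) - z k - 1 / 2)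
    (h0 : (B n : ℚ) = f 0) (h1 : (B (orbit n 1) : ℚ) = f 1) (h2 : (B (orbit n 2) : ℚ) = f 2)
    (h3 : (B (orbit n 3) : ℚ) = f 3) (k : ℕ) :
    2 * (orbit n k : ℚ) + 3 = z (k + 3) ∧ (B (orbit n k) : ℚ) = f k := by
  have hcount : ∀ k, 2 * (letterCount .c (orbit n k) : ℚ) + 1 = z k ∧
      2 * (letterCount .b (orbit n k) : ℚ) + 1 = z (k + 1) ∧
      2 * (letterCount .a (orbit n k) : ℚ) + 1 = z (k + 2) := by
    intro k
    induction k with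
    | zero => exact ⟨hc, hb, ha⟩
    | succ k ih =>
      obtain ⟨i1, i2, i3⟩ := ih
      simp only [orbit, letterCount_a, letterCount_b, letterCount_c]
      refine ⟨i2, i3, ?_⟩
      have h := letterCount_add (orbit n k)
      rw [show k + 1 + 2 = k + 3 from rfl, hz, ← i1, ← i2, ← i3]
      nth_rewrite 1 [← h]
      push_cast
      ring
  have hn : ∀ k, 2 * (orbit n k : ℚ) + 3 = z (k + 3) := by
    intro k
    obtain ⟨i1, i2, i3⟩ := hcount k
    have h := letterCount_add (orbit n k)
    rw [hz, ← i1, ← i2, ← i3]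
    nth_rewrite 1 [← h]
    push_cast
    ring
  refine ⟨hn k, ?_⟩
  have hB : (B (orbit n k) : ℚ) = f k ∧ (B (orbit n (k + 1)) : ℚ) = f (k + 1) ∧
      (B (orbit n (k + 2)) : ℚ) = f (k + 2) ∧ (B (orbit n (k + 3)) : ℚ) = f (k + 3) := by
    induction k with
    | zero => exact ⟨h0, h1, h2, h3⟩
    | succ k ih =>
      obtain ⟨i0, i1, i2, i3⟩ := ih
      refine ⟨i1, i2, i3, ?_⟩
      have h := congrArg (Nat.cast (R := ℚ)) (B_orbit_four (orbit n k))
      rw [orbit_add, orbit_add] at h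
      push_cast at h
      rw [i0, i3] at h
      rw [show k + 1 + 3 = k + 4 from rfl, hf]
      linarith [(hcount k).1, hn k]
  exact hB.1

theorem state_eight : B 8 = 1 ∧ B (orbit 8 1) = 5 ∧ B (orbit 8 2) = 16 ∧ B (orbit 8 3) = 45 ∧
    letterCount .a 8 = 5 ∧ letterCount .b 8 = 2 ∧ letterCount .c 8 = 1 := by
  rw [B_orbit_three, B_orbit_two, orbit, orbit, B_phi_add_one, B_eq]
  decide +kernel

theorem state_ten : B 10 = 2 ∧ B (orbit 10 1) = 7 ∧ B (orbit 10 2) = 23 ∧ B (orbit 10 3) = 62 ∧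
    letterCount .a 10 = 6 ∧ letterCount .b 10 = 3 ∧ letterCount .c 10 = 1 := by
  rw [B_orbit_three, B_orbit_two, orbit, orbit, B_phi_add_one, B_eq]
  decide +kernel

theorem state_fourteen : B 14 = 3 ∧ B (orbit 14 1) = 12 ∧ B (orbit 14 2) = 36 ∧
    B (orbit 14 3) = 94 ∧
    letterCount .a 14 = 8 ∧ letterCount .b 14 = 4 ∧ letterCount .c 14 = 2 := by
  rw [B_orbit_three, B_orbit_two, orbit, orbit, B_phi_add_one, B_eq]
  decide +kernel

end Tribonacci

theorem repeated_squares_at_block_ends (m : ℤ) (hm : 4 ≤ m) :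
    ((B ((4 * t (m - 1) + t (m - 2) - t m - 3) / 2) : ℚ) =
      (m : ℚ) / 44 * (-25 * (t m : ℚ) + 48 * (t (m - 1) : ℚ) + 31 * (t (m - 2) : ℚ)) +
        1 / 44 * (173 * (t m : ℚ) - 294 * (t (m - 1) : ℚ) - 213 * (t (m - 2) : ℚ)) +
        ((m : ℚ) + 11) / 4) ∧
    ((B ((t m + 2 * t (m - 1) - t (m - 2) - 3) / 2) : ℚ) =
      (m : ℚ) / 44 * (-5 * (t m : ℚ) + 36 * (t (m - 1) : ℚ) - 7 * (t (m - 2) : ℚ)) +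
        1 / 22 * (-8 * (t m : ℚ) - 69 * (t (m - 1) : ℚ) + 59 * (t (m - 2) : ℚ)) +
        ((m : ℚ) + 10) / 4) ∧
    ((B ((t m + 2 * t (m - 1) + t (m - 2) - 3) / 2) : ℚ) =
      (m : ℚ) / 44 * (3 * (t m : ℚ) + 18 * (t (m - 1) : ℚ) + 13 * (t (m - 2) : ℚ)) +
        1 / 44 * (3 * (t m : ℚ) - 102 * (t (m - 1) : ℚ) - 51 * (t (m - 2) : ℚ)) +
        ((m : ℚ) + 9) / 4) := by
  obtain ⟨k, rfl⟩ : ∃ k : ℕ, m = (k : ℤ) + 4 := ⟨(m - 4).toNat, by omega⟩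
  have e0 : t ((k : ℤ) + 4) = tribAux (k + 6) := by
    rw [t]; congr 1
  have e1 : t ((k : ℤ) + 4 - 1) = tribAux (k + 5) := by
    rw [t]; congr 1; omega
  have e2 : t ((k : ℤ) + 4 - 2) = tribAux (k + 4) := by
    rw [t]; congr 1; omega
  rw [e0, e1, e2]
  push_cast
  refine ⟨?_, ?_, ?_⟩
  · obtain ⟨h0, h1, h2, h3, ha, hb, hc⟩ := Tribonacci.state_eight
    obtain ⟨hn, hB⟩ := Tribonacci.orbit_closed_form 8
      (fun k => -5 * (tribAux (k + 6) : ℚ) + 8 * tribAux (k + 5) + 3 * tribAux (k + 4))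
      (fun k => ((k : ℚ) + 4) / 44 * (-25 * (tribAux (k + 6) : ℚ) + 48 * (tribAux (k + 5) : ℚ) +
          31 * (tribAux (k + 4) : ℚ)) +
        1 / 44 * (173 * (tribAux (k + 6) : ℚ) - 294 * (tribAux (k + 5) : ℚ) -
          213 * (tribAux (k + 4) : ℚ)) + ((k : ℚ) + 4 + 11) / 4)
      (fun k => by simp only [tribAux]; push_cast; ring)
      (by rw [hc]; norm_num [tribAux]) (by rw [hb]; norm_num [tribAux])
      (by rw [ha]; norm_num [tribAux])
      (fun k => by simp only [tribAux]; push_cast; ring)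
      (by rw [h0]; norm_num [tribAux]) (by rw [h1]; norm_num [tribAux])
      (by rw [h2]; norm_num [tribAux]) (by rw [h3]; norm_num [tribAux]) k
    rw [← hB]
    have hn' : 2 * (Tribonacci.orbit 8 k : ℚ) + 3 + tribAux (k + 6) =
        4 * tribAux (k + 5) + tribAux (k + 4) := by
      rw [hn]; simp only [tribAux]; push_cast; ring
    norm_cast at hn'
    congr 2
    omega
  · obtain ⟨h0, h1, h2, h3, ha, hb, hc⟩ := Tribonacci.state_ten
    obtain ⟨hn, hB⟩ := Tribonacci.orbit_closed_form 10
      (fun k => -(tribAux (k + 6) : ℚ) + 4 * tribAux (k + 5) - 3 * tribAux (k + 4))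
      (fun k => ((k : ℚ) + 4) / 44 * (-5 * (tribAux (k + 6) : ℚ) + 36 * (tribAux (k + 5) : ℚ) -
          7 * (tribAux (k + 4) : ℚ)) +
        1 / 22 * (-8 * (tribAux (k + 6) : ℚ) - 69 * (tribAux (k + 5) : ℚ) +
          59 * (tribAux (k + 4) : ℚ)) + ((k : ℚ) + 4 + 10) / 4)
      (fun k => by simp only [tribAux]; push_cast; ring)
      (by rw [hc]; norm_num [tribAux]) (by rw [hb]; norm_num [tribAux])
      (by rw [ha]; norm_num [tribAux])
      (fun k => by simp only [tribAux]; push_cast; ring)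
      (by rw [h0]; norm_num [tribAux]) (by rw [h1]; norm_num [tribAux])
      (by rw [h2]; norm_num [tribAux]) (by rw [h3]; norm_num [tribAux]) k
    rw [← hB]
    have hn' : 2 * (Tribonacci.orbit 10 k : ℚ) + 3 + tribAux (k + 4) =
        tribAux (k + 6) + 2 * tribAux (k + 5) := by
      rw [hn]; simp only [tribAux]; push_cast; ring
    norm_cast at hn'
    congr 2
    omega
  · obtain ⟨h0, h1, h2, h3, ha, hb, hc⟩ := Tribonacci.state_fourteen
    obtain ⟨hn, hB⟩ := Tribonacci.orbit_closed_form 14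
      (fun k => -(tribAux (k + 6) : ℚ) + 2 * tribAux (k + 5) + tribAux (k + 4))
      (fun k => ((k : ℚ) + 4) / 44 * (3 * (tribAux (k + 6) : ℚ) + 18 * (tribAux (k + 5) : ℚ) +
          13 * (tribAux (k + 4) : ℚ)) +
        1 / 44 * (3 * (tribAux (k + 6) : ℚ) - 102 * (tribAux (k + 5) : ℚ) -
          51 * (tribAux (k + 4) : ℚ)) + ((k : ℚ) + 4 + 9) / 4)
      (fun k => by simp only [tribAux]; push_cast; ring)
      (by rw [hc]; norm_num [tribAux]) (by rw [hb]; norm_num [tribAux])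
      (by rw [ha]; norm_num [tribAux])
      (fun k => by simp only [tribAux]; push_cast; ring)
      (by rw [h0]; norm_num [tribAux]) (by rw [h1]; norm_num [tribAux])
      (by rw [h2]; norm_num [tribAux]) (by rw [h3]; norm_num [tribAux]) k
    rw [← hB]
    have hn' : 2 * (Tribonacci.orbit 14 k : ℚ) + 3 =
        tribAux (k + 6) + 2 * tribAux (k + 5) + tribAux (k + 4) := by
      rw [hn]; simp only [tribAux]; push_cast; ring
    norm_cast at hn'
    congr 2
    omega
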